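/- arXiv:2509.13262 — 3 statements merged into one kernel-verified Lean document; each statement's English description precedes it below -/
import Mathlib

section
/- Let Y be a real-valued integrable random variable on a probability space and set t = E[Y]. Assume P(Y > t) > 0 and P(Y < t) > 0. Define MAD = E[|Y − t| | Y ≠ t], MAD⁺ = E[Y − t | Y > t], and MAD⁻ = E[t − Y | Y < t]. Then MAD⁺ > 0, MAD⁻ > 0, and MAD equals the harmonic mean of MAD⁺ and MAD⁻, i.e., MAD = 2·MAD⁺·MAD⁻ / (MAD⁺ + MAD⁻). -/
open MeasureTheory

/-- **Self-Consistency Constraint.** For an integrable real random variable `Y` with mean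
`t = E[Y]`, if `P(Y > t) > 0` and `P(Y < t) > 0`, then the one-sided mean absolute
deviations are positive, and the total mean absolute deviation (conditioned on `Y ≠ t`)
equals the harmonic mean of the one-sided deviations. -/
theorem split_point_self_consistency
    {Ω : Type*} [MeasurableSpace Ω] (μ : Measure Ω) [IsProbabilityMeasure μ]
    (Y : Ω → ℝ) (hYm : Measurable Y) (hY : Integrable Y μ)
    (t : ℝ) (ht : t = ∫ ω, Y ω ∂μ)
    (hpos : 0 < μ {ω | Y ω > t}) (hneg : 0 < μ {ω | Y ω < t})
    (MAD MADp MADm : ℝ)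
    (hMAD : MAD = (∫ ω in {ω | Y ω ≠ t}, |Y ω - t| ∂μ) / (μ {ω | Y ω ≠ t}).toReal)
    (hMADp : MADp = (∫ ω in {ω | Y ω > t}, (Y ω - t) ∂μ) / (μ {ω | Y ω > t}).toReal)
    (hMADm : MADm = (∫ ω in {ω | Y ω < t}, (t - Y ω) ∂μ) / (μ {ω | Y ω < t}).toReal) :
    0 < MADp ∧ 0 < MADm ∧ MAD = 2 * MADp * MADm / (MADp + MADm) := by
  have hA : MeasurableSet {ω | Y ω > t} := measurableSet_lt measurable_const hYm
  have hB : MeasurableSet {ω | Y ω < t} := measurableSet_lt hYm measurable_const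
  have hN : {ω | Y ω ≠ t} = {ω | Y ω > t} ∪ {ω | Y ω < t} := by
    ext ω
    exact ne_iff_lt_or_gt.trans or_comm
  have hdisj : Disjoint {ω | Y ω > t} {ω | Y ω < t} :=
    Set.disjoint_left.2 fun ω h h' => lt_asymm (Set.mem_ofPred.1 h) (Set.mem_ofPred.1 h')
  have hup : Integrable (fun ω => Y ω - t) μ := hY.sub (integrable_const t)
  have hupos : 0 < ∫ ω in {ω | Y ω > t}, (Y ω - t) ∂μ := by
    rw [setIntegral_pos_iff_support_of_nonneg_ae
      ((ae_restrict_iff' hA).2 (.of_forall fun ω hω => sub_nonneg.2 (le_of_lt hω)))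
      hup.integrableOn]
    refine hpos.trans_le (measure_mono fun ω hω => ⟨?_, hω⟩)
    exact sub_ne_zero.2 (ne_of_gt hω)
  have hmean : ∫ ω in {ω | Y ω ≠ t}, (Y ω - t) ∂μ = 0 := by
    have hzero : ∀ ω, ω ∉ {ω | Y ω ≠ t} → Y ω - t = 0 :=
      fun ω hω => sub_eq_zero.2 (not_not.1 hω)
    rw [setIntegral_eq_integral_of_forall_compl_eq_zero hzero, integral_sub hY (integrable_const t), ← ht]
    simp
  have hbalance : ∫ ω in {ω | Y ω < t}, (t - Y ω) ∂μ = ∫ ω in {ω | Y ω > t}, (Y ω - t) ∂μ := by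
    rw [hN, setIntegral_union hdisj hB hup.integrableOn hup.integrableOn] at hmean
    have hflip : ∫ ω in {ω | Y ω < t}, (t - Y ω) ∂μ = -∫ ω in {ω | Y ω < t}, (Y ω - t) ∂μ := by
      simp_rw [← integral_neg, neg_sub]
    linarith
  have htotal : ∫ ω in {ω | Y ω ≠ t}, |Y ω - t| ∂μ =
      2 * ∫ ω in {ω | Y ω > t}, (Y ω - t) ∂μ := by
    rw [hN, setIntegral_union hdisj hB hup.abs.integrableOn hup.abs.integrableOn,
      setIntegral_congr_fun hA fun ω hω => abs_of_pos (sub_pos.2 hω),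
      setIntegral_congr_fun hB fun ω hω =>
        (abs_of_neg (sub_neg.2 hω)).trans (neg_sub _ _), hbalance, two_mul]
  have hmeasure : (μ {ω | Y ω ≠ t}).toReal =
      (μ {ω | Y ω > t}).toReal + (μ {ω | Y ω < t}).toReal := by
    rw [hN, measure_union hdisj hB,
      ENNReal.toReal_add (measure_ne_top _ _) (measure_ne_top _ _)]
  have hp : 0 < (μ {ω | Y ω > t}).toReal := ENNReal.toReal_pos hpos.ne' (measure_ne_top _ _)
  have hq : 0 < (μ {ω | Y ω < t}).toReal := ENNReal.toReal_pos hneg.ne' (measure_ne_top _ _)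
  rw [htotal, hmeasure] at hMAD
  rw [hbalance] at hMADm
  subst hMAD hMADp hMADm
  refine ⟨div_pos hupos hp, div_pos hupos hq, ?_⟩
  generalize ∫ ω in {ω | Y ω > t}, (Y ω - t) ∂μ = S at *
  generalize (μ {ω | Y ω > t}).toReal = p at *
  generalize (μ {ω | Y ω < t}).toReal = q at *
  have hsum : p + q ≠ 0 := (add_pos hp hq).ne'
  have hden : S / p + S / q ≠ 0 := (add_pos (div_pos hupos hp) (div_pos hupos hq)).ne'
  rw [div_eq_div_iff hsum hden]
  field_simp
  ring
end

section
/- Let Y be a real-valued integrable random variable and t ∈ ℝ with P(Y > t) > 0 and P(Y < t) > 0. Define the self-consistency discrepancy Δ(t) = |MAD(t) − 2·MAD⁺(t)·MAD⁻(t)/(MAD⁺(t) + MAD⁻(t))|. Then Δ(t) ≥ 0 for all such t, and Δ(t) = 0 if and only if t = E[Y] or MAD⁺(t) = MAD⁻(t); in particular Δ attains its global minimum value zero at t = E[Y] and at any balance point where MAD⁺(t) = MAD⁻(t). -/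
open MeasureTheory

/-- Total mean absolute deviation about `t`, conditioned on `Y ≠ t`. -/
noncomputable def totMAD {Ω : Type*} [MeasurableSpace Ω] (μ : Measure Ω)
    (Y : Ω → ℝ) (t : ℝ) : ℝ :=
  (∫ ω in {ω | Y ω ≠ t}, |Y ω - t| ∂μ) / (μ {ω | Y ω ≠ t}).toReal

/-- Upper-side mean absolute deviation: `E[Y − t | Y > t]`. -/
noncomputable def upMAD {Ω : Type*} [MeasurableSpace Ω] (μ : Measure Ω)
    (Y : Ω → ℝ) (t : ℝ) : ℝ :=
  (∫ ω in {ω | Y ω > t}, (Y ω - t) ∂μ) / (μ {ω | Y ω > t}).toReal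

/-- Lower-side mean absolute deviation: `E[t − Y | Y < t]`. -/
noncomputable def loMAD {Ω : Type*} [MeasurableSpace Ω] (μ : Measure Ω)
    (Y : Ω → ℝ) (t : ℝ) : ℝ :=
  (∫ ω in {ω | Y ω < t}, (t - Y ω) ∂μ) / (μ {ω | Y ω < t}).toReal

/-- Self-consistency discrepancy `Δ(t) = |MAD(t) − H(MAD⁺(t), MAD⁻(t))|`. -/
noncomputable def scDisc {Ω : Type*} [MeasurableSpace Ω] (μ : Measure Ω)
    (Y : Ω → ℝ) (t : ℝ) : ℝ :=
  |totMAD μ Y t - 2 * upMAD μ Y t * loMAD μ Y t / (upMAD μ Y t + loMAD μ Y t)|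

/-- Weighted-mean form of the comparison between arithmetic and harmonic means. -/
lemma weighted_mean_eq_harmonic_mean_iff {a b p q : ℝ} (ha : 0 < a) (hb : 0 < b)
    (hp : 0 < p) (hq : 0 < q) :
    (a + b) / (p + q) = 2 * (a / p) * (b / q) / (a / p + b / q) ↔ a = b ∨ a / p = b / q := by
  obtain ⟨u, rfl⟩ : ∃ u, a = p * u := ⟨a / p, by field_simp⟩
  obtain ⟨l, rfl⟩ : ∃ l, b = q * l := ⟨b / q, by field_simp⟩
  have hu : 0 < u := pos_of_mul_pos_right ha hp.le
  have hl : 0 < l := pos_of_mul_pos_right hb hq.le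
  rw [mul_div_cancel_left₀ u hp.ne', mul_div_cancel_left₀ l hq.ne',
    div_eq_div_iff (by positivity) (by positivity), ← sub_eq_zero,
    ← sub_eq_zero (a := p * u), ← sub_eq_zero (a := u), ← mul_eq_zero]
  ring_nf

lemma setOf_ne_eq_union_gt_lt {Ω : Type*} (Y : Ω → ℝ) (t : ℝ) :
    {ω | Y ω ≠ t} = {ω | Y ω > t} ∪ {ω | Y ω < t} := by
  ext ω
  exact ne_iff_lt_or_gt.trans or_comm

lemma disjoint_setOf_gt_lt {Ω : Type*} (Y : Ω → ℝ) (t : ℝ) :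
    Disjoint {ω | Y ω > t} {ω | Y ω < t} :=
  Set.disjoint_left.2 fun ω (h : t < Y ω) (h' : Y ω < t) => lt_asymm h h'

section SplitPoint

variable {Ω : Type*} [MeasurableSpace Ω] {μ : Measure Ω} {Y : Ω → ℝ}

lemma setIntegral_ne_eq_gt_add_lt (hYm : Measurable Y) (t : ℝ) {f : Ω → ℝ}
    (hf : Integrable f μ) :
    ∫ ω in {ω | Y ω ≠ t}, f ω ∂μ =
      ∫ ω in {ω | Y ω > t}, f ω ∂μ + ∫ ω in {ω | Y ω < t}, f ω ∂μ := by
  rw [setOf_ne_eq_union_gt_lt]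
  exact setIntegral_union (disjoint_setOf_gt_lt Y t) (measurableSet_lt hYm measurable_const)
    hf.integrableOn hf.integrableOn

lemma setIntegral_abs_sub_ne [IsFiniteMeasure μ] (hYm : Measurable Y) (hY : Integrable Y μ)
    (t : ℝ) :
    ∫ ω in {ω | Y ω ≠ t}, |Y ω - t| ∂μ =
      ∫ ω in {ω | Y ω > t}, (Y ω - t) ∂μ + ∫ ω in {ω | Y ω < t}, (t - Y ω) ∂μ := by
  have hint : Integrable (fun ω => |Y ω - t|) μ := (hY.sub (integrable_const t)).abs
  rw [setIntegral_ne_eq_gt_add_lt hYm t hint]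
  congr 1
  · exact setIntegral_congr_fun (measurableSet_lt measurable_const hYm)
      fun ω hω => abs_of_pos (sub_pos.2 hω)
  · refine setIntegral_congr_fun (measurableSet_lt hYm measurable_const) fun ω hω => ?_
    have h : Y ω < t := hω
    simp only [abs_of_neg (sub_neg.2 h), neg_sub]

lemma integral_sub_eq_setIntegral_sub [IsProbabilityMeasure μ] (hYm : Measurable Y)
    (hY : Integrable Y μ) (t : ℝ) :
    ∫ ω, Y ω ∂μ - t =
      ∫ ω in {ω | Y ω > t}, (Y ω - t) ∂μ - ∫ ω in {ω | Y ω < t}, (t - Y ω) ∂μ := by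
  have hint : Integrable (fun ω => Y ω - t) μ := hY.sub (integrable_const t)
  have hmean : ∫ ω, (Y ω - t) ∂μ = ∫ ω, Y ω ∂μ - t := by
    simp [integral_sub hY (integrable_const t)]
  have hsupp : ∫ ω in {ω | Y ω ≠ t}, (Y ω - t) ∂μ = ∫ ω, (Y ω - t) ∂μ :=
    setIntegral_eq_integral_of_forall_compl_eq_zero fun ω hω => by
      simpa [sub_eq_zero] using hω
  rw [← hmean, ← hsupp, setIntegral_ne_eq_gt_add_lt hYm t hint, sub_eq_add_neg, ← integral_neg]
  simp only [neg_sub]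

end SplitPoint

/-- **Minimum Discrepancy.** For every split point `t` with `P(Y > t) > 0` and
`P(Y < t) > 0`, the discrepancy `Δ(t)` is nonnegative, and it vanishes iff `t = E[Y]` or
`t` is a balance point (`MAD⁺(t) = MAD⁻(t)`); hence `Δ` attains its global minimum value
zero exactly at such points. -/
theorem minimum_discrepancy
    {Ω : Type*} [MeasurableSpace Ω] (μ : Measure Ω) [IsProbabilityMeasure μ]
    (Y : Ω → ℝ) (hYm : Measurable Y) (hY : Integrable Y μ) :
    ∀ t : ℝ, 0 < μ {ω | Y ω > t} → 0 < μ {ω | Y ω < t} →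
      0 ≤ scDisc μ Y t ∧
      (scDisc μ Y t = 0 ↔ t = ∫ ω, Y ω ∂μ ∨ upMAD μ Y t = loMAD μ Y t) := by
  intro t hgt hlt
  refine ⟨abs_nonneg _, ?_⟩
  have hgtm : MeasurableSet {ω | Y ω > t} := measurableSet_lt measurable_const hYm
  have hltm : MeasurableSet {ω | Y ω < t} := measurableSet_lt hYm measurable_const
  have hp : 0 < (μ {ω | Y ω > t}).toReal := ENNReal.toReal_pos hgt.ne' (measure_ne_top _ _)
  have hq : 0 < (μ {ω | Y ω < t}).toReal := ENNReal.toReal_pos hlt.ne' (measure_ne_top _ _)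
  have hmeas : (μ {ω | Y ω ≠ t}).toReal =
      (μ {ω | Y ω > t}).toReal + (μ {ω | Y ω < t}).toReal := by
    rw [setOf_ne_eq_union_gt_lt, measure_union (disjoint_setOf_gt_lt Y t) hltm,
      ENNReal.toReal_add (measure_ne_top _ _) (measure_ne_top _ _)]
  have ha : 0 < ∫ ω in {ω | Y ω > t}, (Y ω - t) ∂μ := by
    rw [setIntegral_pos_iff_support_of_nonneg_ae
      ((ae_restrict_mem hgtm).mono fun ω hω => (sub_pos.2 hω).le)
      (hY.sub (integrable_const t)).integrableOn]
    exact hgt.trans_le (measure_mono fun ω hω => ⟨(sub_pos.2 hω).ne', hω⟩)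
  have hb : 0 < ∫ ω in {ω | Y ω < t}, (t - Y ω) ∂μ := by
    rw [setIntegral_pos_iff_support_of_nonneg_ae
      ((ae_restrict_mem hltm).mono fun ω hω => (sub_pos.2 hω).le)
      ((integrable_const t).sub hY).integrableOn]
    exact hlt.trans_le (measure_mono fun ω hω => ⟨(sub_pos.2 hω).ne', hω⟩)
  have hmean := integral_sub_eq_setIntegral_sub hYm hY t
  rw [scDisc, abs_eq_zero, sub_eq_zero, totMAD, upMAD, loMAD, hmeas,
    setIntegral_abs_sub_ne hYm hY t, weighted_mean_eq_harmonic_mean_iff ha hb hp hq]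
  refine or_congr_left ?_
  rw [← sub_eq_zero, ← hmean, sub_eq_zero, eq_comm]
end

section
/- Let Y be a real-valued integrable random variable and t ∈ ℝ with p⁺ := P(Y > t) > 0 and p⁻ := P(Y < t) > 0, and write a = MAD⁺(t), b = MAD⁻(t), p = p⁺ + p⁻. Then the self-consistency discrepancy admits the closed form Δ(t) = |p⁺·a − p⁻·b| · |a − b| / (p·(a + b)). -/
open MeasureTheory

/-- The integral of a function over a set of positive measure on which it is positive is
positive. -/
theorem setIntegral_pos_of_forall_pos {Ω : Type*} [MeasurableSpace Ω] {μ : Measure Ω}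
    {f : Ω → ℝ} {s : Set Ω} (hs : MeasurableSet s) (hf : IntegrableOn f s μ)
    (hpos : ∀ ω ∈ s, 0 < f ω) (hμ : 0 < μ s) : 0 < ∫ ω in s, f ω ∂μ := by
  rw [setIntegral_pos_iff_support_of_nonneg_ae
    (ae_restrict_of_forall_mem hs fun ω hω => (hpos ω hω).le) hf]
  rwa [Set.inter_eq_right.mpr fun ω hω => Function.mem_support.mpr (hpos ω hω).ne']

/-- **Closed form of the self-consistency discrepancy.** For a split point `t` with
`p⁺ = P(Y > t) > 0` and `p⁻ = P(Y < t) > 0`, writing `a = MAD⁺(t)`, `b = MAD⁻(t)` and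
`p = p⁺ + p⁻`, the discrepancy `Δ(t) = |MAD(t) − 2ab/(a+b)|` equals
`|p⁺·a − p⁻·b| · |a − b| / (p·(a + b))`. -/
theorem discrepancy_closed_form
    {Ω : Type*} [MeasurableSpace Ω] (μ : Measure Ω) [IsProbabilityMeasure μ]
    (Y : Ω → ℝ) (hYm : Measurable Y) (hY : Integrable Y μ) (t : ℝ)
    (hpos : 0 < μ {ω | Y ω > t}) (hneg : 0 < μ {ω | Y ω < t})
    (pp pm MAD a b : ℝ)
    (hpp : pp = (μ {ω | Y ω > t}).toReal)
    (hpm : pm = (μ {ω | Y ω < t}).toReal)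
    (hMAD : MAD = (∫ ω in {ω | Y ω ≠ t}, |Y ω - t| ∂μ) / (μ {ω | Y ω ≠ t}).toReal)
    (ha : a = (∫ ω in {ω | Y ω > t}, (Y ω - t) ∂μ) / (μ {ω | Y ω > t}).toReal)
    (hb : b = (∫ ω in {ω | Y ω < t}, (t - Y ω) ∂μ) / (μ {ω | Y ω < t}).toReal) :
    |MAD - 2 * a * b / (a + b)| = |pp * a - pm * b| * |a - b| / ((pp + pm) * (a + b)) := by
  have hgt : MeasurableSet {ω | Y ω > t} := measurableSet_lt measurable_const hYm
  have hlt : MeasurableSet {ω | Y ω < t} := measurableSet_lt hYm measurable_const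
  have hdisj : Disjoint {ω | Y ω > t} {ω | Y ω < t} :=
    Set.disjoint_left.mpr fun ω (h₁ : t < Y ω) (h₂ : Y ω < t) => lt_asymm h₁ h₂
  have hunion : {ω | Y ω ≠ t} = {ω | Y ω > t} ∪ {ω | Y ω < t} := by
    ext ω
    exact ne_iff_gt_or_lt
  have hint : Integrable (fun ω => Y ω - t) μ := hY.sub (integrable_const t)
  have hint' : Integrable (fun ω => t - Y ω) μ := (integrable_const t).sub hY
  have hpp0 : 0 < pp := hpp ▸ ENNReal.toReal_pos hpos.ne' (measure_ne_top μ _)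
  have hpm0 : 0 < pm := hpm ▸ ENNReal.toReal_pos hneg.ne' (measure_ne_top μ _)
  have hmeas : (μ {ω | Y ω ≠ t}).toReal = pp + pm := by
    rw [hunion, measure_union hdisj hlt,
      ENNReal.toReal_add (measure_ne_top μ _) (measure_ne_top μ _), hpp, hpm]
  have hA : 0 < ∫ ω in {ω | Y ω > t}, (Y ω - t) ∂μ :=
    setIntegral_pos_of_forall_pos hgt hint.integrableOn (fun _ h => sub_pos.mpr h) hpos
  have hB : 0 < ∫ ω in {ω | Y ω < t}, (t - Y ω) ∂μ :=
    setIntegral_pos_of_forall_pos hlt hint'.integrableOn (fun _ h => sub_pos.mpr h) hneg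
  have habs : ∫ ω in {ω | Y ω ≠ t}, |Y ω - t| ∂μ =
      (∫ ω in {ω | Y ω > t}, (Y ω - t) ∂μ) + ∫ ω in {ω | Y ω < t}, (t - Y ω) ∂μ := by
    rw [hunion, setIntegral_union hdisj hlt hint.abs.integrableOn hint.abs.integrableOn]
    congr 1
    · exact setIntegral_congr_fun hgt fun ω h => abs_of_pos (sub_pos.mpr h)
    · exact setIntegral_congr_fun hlt fun ω h =>
        (abs_of_neg (sub_neg.mpr h)).trans (neg_sub _ _)
  rw [← hpp] at ha
  rw [← hpm] at hb
  rw [habs, hmeas, (div_eq_iff hpp0.ne').mp ha.symm, (div_eq_iff hpm0.ne').mp hb.symm] at hMAD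
  have ha0 : 0 < a := ha ▸ div_pos hA hpp0
  have hb0 : 0 < b := hb ▸ div_pos hB hpm0
  have hfactor : MAD - 2 * a * b / (a + b) =
      (pp * a - pm * b) * (a - b) / ((pp + pm) * (a + b)) := by
    rw [hMAD]
    field_simp
    ring
  rw [hfactor, abs_div, abs_mul, abs_of_pos (show 0 < (pp + pm) * (a + b) by positivity)]
end
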